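/- Let k > 0 and h > 0 satisfy k·h = π/2. Let r̂₋, r̂₊ : ℝ → ℂ be affine functions (r̂±(x) = α± + β±·x) and define the residual r(x) = r̂₋(x)·e^{-ikx} + r̂₊(x)·e^{ikx}. Then the separation procedure is exact: for every x ∈ ℝ, (1/4)·( e^{ik(x−h)}·r(x−h) + 2·e^{ikx}·r(x) + e^{ik(x+h)}·r(x+h) ) = r̂₋(x), and symmetrically (1/4)·( e^{-ik(x−h)}·r(x−h) + 2·e^{-ikx}·r(x) + e^{-ik(x+h)}·r(x+h) ) = r̂₊(x). -/

import Mathlib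

open Complex

/-- When `kh = π/2` and the ray residuals `r̂₋, r̂₊` are affine, the wave-ray
separation procedure (full weighting applied to `e^{±ikx}·r(x)`) recovers the
ray residuals exactly. -/
theorem separation_exact_for_affine_residuals (k h : ℝ) (hk : 0 < k) (hh : 0 < h)
    (hkh : k * h = Real.pi / 2) (αm βm αp βp : ℂ)
    (rm rp r : ℝ → ℂ)
    (hrm : ∀ x : ℝ, rm x = αm + βm * x)
    (hrp : ∀ x : ℝ, rp x = αp + βp * x)
    (hr : ∀ x : ℝ, r x = rm x * exp (-(I * k * x)) + rp x * exp (I * k * x)) :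
    ∀ x : ℝ,
      (1 / 4 : ℂ) * (exp (I * k * (x - h)) * r (x - h) + 2 * exp (I * k * x) * r x
          + exp (I * k * (x + h)) * r (x + h)) = rm x
      ∧ (1 / 4 : ℂ) * (exp (-(I * k * (x - h))) * r (x - h) + 2 * exp (-(I * k * x)) * r x
          + exp (-(I * k * (x + h))) * r (x + h)) = rp x := by
  intro x
  have hkh' : (k : ℂ) * h = Real.pi / 2 := by exact_mod_cast hkh
  have hI : exp (I * k * h) = I := by
    rw [mul_assoc, hkh', mul_comm, exp_pi_div_two_mul_I]
  have hE : exp (I * k * x) * exp (-(I * k * x)) = 1 := by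
    rw [← exp_add, add_neg_cancel, exp_zero]
  have hI' : exp (-(I * k * h)) = -I := by
    rw [exp_neg, hI, inv_I]
  have e1 : exp (I * k * (x - h)) = exp (I * k * x) * -I := by
    rw [mul_sub, sub_eq_add_neg, exp_add, hI']
  have e2 : exp (I * k * (x + h)) = exp (I * k * x) * I := by
    rw [mul_add, exp_add, hI]
  have e3 : exp (-(I * k * (x - h))) = exp (-(I * k * x)) * I := by
    rw [mul_sub, neg_sub, sub_eq_neg_add, exp_add, hI]
  have e4 : exp (-(I * k * (x + h))) = exp (-(I * k * x)) * -I := by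
    rw [mul_add, neg_add, exp_add, hI']
  simp only [hr, hrm, hrp, ofReal_sub, ofReal_add, e1, e2, e3, e4]
  generalize exp (I * k * x) = E at *
  generalize exp (-(I * k * x)) = F at *
  have hI2 : I * I = -1 := I_mul_I
  constructor
  · grind
  · grind
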